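/- arXiv:2405.13149 — 4 statements merged into one kernel-verified Lean document; each statement's English description precedes it below -/
import Mathlib

section
/- Let ρ be the joint law on ℝ^N × X of (φ(u), u) for u ∼ μ, and let z ↦ μ^z be the disintegration of ρ over its first marginal η = φ_♯μ, i.e. the Markov kernel satisfying ∫_X 1_E(φ(u)) 1_A(u) μ(du) = ∫_E μ^z(A) η(dz) for all Borel E ⊆ ℝ^N and A ⊆ X. Then for η-almost every z ∈ ℝ^N, the measure μ^z is a Gaussian measure on X (its pushforward under every continuous linear functional is a Gaussian on ℝ) with mean ϕᵀ z, i.e. ∫_X ⟨f, u⟩ μ^z(du) = ⟨f, ϕᵀ z⟩ for all f ∈ X, and covariance operator K^φ, i.e. ∫_X ⟨f, u − ϕᵀz⟩ ⟨g, u − ϕᵀz⟩ μ^z(du) = ⟨f, K^φ g⟩ for all f, g ∈ X. -/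
open MeasureTheory ProbabilityTheory Filter Topology Metric
open scoped ENNReal NNReal RealInnerProductSpace

noncomputable section

/-- A centered Gaussian measure on a Hilbert space: the pushforward under every
continuous linear functional is a centered real Gaussian. -/
def IsCenteredGaussian {X : Type*} [NormedAddCommGroup X] [InnerProductSpace ℝ X]
    [MeasurableSpace X] (μ : Measure X) : Prop :=
  ∀ f : X →L[ℝ] ℝ, ∃ v : ℝ≥0, μ.map f = gaussianReal 0 v

section Disintegration

variable {E X : Type*} [MeasurableSpace E] [MeasurableSpace X] [Add X] [MeasurableAdd₂ X]

/-- The translation kernel `z ↦ law of T z + r` for `r ∼ ν`. -/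
def translateKernel (ν : Measure X) (T : E → X) : Kernel E X :=
  (Kernel.id ×ₖ Kernel.const E ν).map fun p : E × X => T p.1 + p.2

lemma translateKernel_apply (ν : Measure X) [SFinite ν] {T : E → X} (hT : Measurable T) (z : E) :
    translateKernel ν T z = ν.map (T z + ·) := by
  have hg : Measurable fun p : E × X => T p.1 + p.2 := by fun_prop
  rw [translateKernel, Kernel.map_apply _ hg, Kernel.prod_apply, Kernel.id_apply,
    Kernel.const_apply, Measure.dirac_prod, Measure.map_map hg (by fun_prop)]
  rfl

/-- If `u = T (Φ u) + R u` with `Φ` and `R` independent, then conditionally on `Φ = z` the law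
of `u` is that of `T z + R`. -/
lemma ae_eq_map_add_of_indepFun [MeasurableSpace.CountablyGenerated X]
    {μ : Measure X} [IsProbabilityMeasure μ] {Φ : X → E} {R : X → X} {T : E → X}
    (hΦ : Measurable Φ) (hR : Measurable R) (hT : Measurable T)
    (hdecomp : ∀ u, T (Φ u) + R u = u) (hind : IndepFun Φ R μ)
    (κ : Kernel E X) [IsMarkovKernel κ]
    (hκ : ∀ (B : Set E) (A : Set X), MeasurableSet B → MeasurableSet A →
      μ.map (fun u => (Φ u, u)) (B ×ˢ A) = ∫⁻ z in B, κ z A ∂(μ.map Φ)) :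
    ∀ᵐ z ∂(μ.map Φ), κ z = (μ.map R).map (T z + ·) := by
  have := Measure.isProbabilityMeasure_map (μ := μ) hΦ.aemeasurable
  have := Measure.isProbabilityMeasure_map (μ := μ) hR.aemeasurable
  have hg : Measurable fun p : E × X => T p.1 + p.2 := by fun_prop
  have : IsMarkovKernel (translateKernel (μ.map R) T) := Kernel.IsMarkovKernel.map _ hg
  have hprod : (μ.map Φ) ⊗ₘ κ = (μ.map Φ) ⊗ₘ translateKernel (μ.map R) T := by
    refine Measure.ext_prod fun {B A} hB hA => ?_
    have hS : MeasurableSet {p : E × X | p.1 ∈ B ∧ T p.1 + p.2 ∈ A} :=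
      (measurable_fst hB).inter (hg hA)
    rw [Measure.compProd_apply_prod hB hA, Measure.compProd_apply_prod hB hA, ← hκ B A hB hA,
      Measure.map_apply (by fun_prop) (hB.prod hA)]
    have hpre : (fun u => (Φ u, u)) ⁻¹' (B ×ˢ A)
        = (fun u => (Φ u, R u)) ⁻¹' {p : E × X | p.1 ∈ B ∧ T p.1 + p.2 ∈ A} := by
      ext u
      simp [hdecomp]
    rw [hpre, ← Measure.map_apply (by fun_prop) hS,
      (indepFun_iff_map_prod_eq_prod_map_map hΦ.aemeasurable hR.aemeasurable).1 hind,
      Measure.prod_apply hS, ← lintegral_indicator hB]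
    refine lintegral_congr fun z => ?_
    by_cases hz : z ∈ B
    · rw [Set.indicator_of_mem hz, translateKernel_apply _ hT,
        Measure.map_apply (by fun_prop) hA]
      simp [hz, Set.preimage]
    · simp [hz, Set.preimage]
  filter_upwards [Kernel.ae_eq_of_compProd_eq hprod] with z hz
  rw [hz, translateKernel_apply _ hT]

end Disintegration

lemma IsCenteredGaussian.isGaussian {X : Type*} [NormedAddCommGroup X] [InnerProductSpace ℝ X]
    [MeasurableSpace X] [BorelSpace X] {μ : Measure X} (hμ : IsCenteredGaussian μ) :
    IsGaussian μ :=
  isGaussian_of_map_eq_gaussianReal fun L => ⟨0, hμ L⟩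

lemma IsCenteredGaussian.integral_dual {X : Type*} [NormedAddCommGroup X] [InnerProductSpace ℝ X]
    [MeasurableSpace X] [BorelSpace X] {μ : Measure X} (hμ : IsCenteredGaussian μ)
    (L : X →L[ℝ] ℝ) : ∫ u, L u ∂μ = 0 := by
  obtain ⟨v, hv⟩ := hμ L
  calc ∫ u, L u ∂μ = ∫ x, x ∂(μ.map L) :=
        (integral_map L.continuous.measurable.aemeasurable aestronglyMeasurable_id).symm
    _ = 0 := by rw [hv, integral_id_gaussianReal]

theorem statement_2
    {X : Type*} [NormedAddCommGroup X] [InnerProductSpace ℝ X] [CompleteSpace X]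
    [SecondCountableTopology X] [MeasurableSpace X] [BorelSpace X]
    {N : ℕ}
    (μ : Measure X) [IsProbabilityMeasure μ] (hμ : IsCenteredGaussian μ)
    (K : X →L[ℝ] X)
    (hK : ∀ f g : X, ⟪K f, g⟫ = ∫ u, ⟪f, u⟫ * ⟪g, u⟫ ∂μ)
    (φ : Fin N → (X →L[ℝ] ℝ))
    -- the map `φ = (φ₁, …, φ_N) : X → ℝ^N`
    (Φ : X → EuclideanSpace ℝ (Fin N))
    (hΦ : ∀ u i, Φ u i = φ i u)
    -- `θᵢ = K φᵢ*`, where `φᵢ*` is the Riesz representer of `φᵢ`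
    (θ : Fin N → X)
    (hθ : ∀ i, θ i = K ((InnerProductSpace.toDual ℝ X).symm (φ i)))
    -- the Gram matrix `Θᵢⱼ = φᵢ(K φⱼ*)`, assumed invertible
    (Θ : Matrix (Fin N) (Fin N) ℝ)
    (hΘdef : ∀ i j, Θ i j = φ i (θ j))
    (hΘinv : IsUnit Θ.det)
    -- the gamblets `ϕᵢ = Σⱼ (Θ⁻¹)ᵢⱼ θⱼ` and the reconstruction map `ϕᵀ`
    (ϕ : Fin N → X)
    (hϕ : ∀ i, ϕ i = ∑ j, Θ⁻¹ i j • θ j)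
    (ϕT : EuclideanSpace ℝ (Fin N) → X)
    (hϕT : ∀ z, ϕT z = ∑ i, z i • ϕ i)
    -- the conditional covariance operator `K^φ`
    (Kφ : X → X)
    (hKφ : ∀ f, Kφ f = K f - ∑ i, ∑ j, (Θ⁻¹ i j * ⟪θ j, f⟫) • θ i)
    -- the joint law `ρ` of `(φ(u), u)` for `u ∼ μ`
    (ρ : Measure (EuclideanSpace ℝ (Fin N) × X))
    (hρ : ρ = μ.map fun u => (Φ u, u))
    -- a Markov kernel disintegrating `ρ` over its first marginal `η = φ_♯ μ`
    (κ : EuclideanSpace ℝ (Fin N) → Measure X)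
    (hκprob : ∀ z, IsProbabilityMeasure (κ z))
    (hκmeas : ∀ A : Set X, MeasurableSet A → Measurable fun z => κ z A)
    (hκ : ∀ (E : Set (EuclideanSpace ℝ (Fin N))) (A : Set X),
      MeasurableSet E → MeasurableSet A →
        ρ (E ×ˢ A) = ∫⁻ z in E, κ z A ∂(μ.map Φ)) :
    ∀ᵐ z ∂(μ.map Φ),
      (∀ f : X →L[ℝ] ℝ, ∃ (m : ℝ) (v : ℝ≥0), (κ z).map f = gaussianReal m v) ∧
      (∀ f : X, ∫ u, ⟪f, u⟫ ∂(κ z) = ⟪f, ϕT z⟫) ∧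
      (∀ f g : X, ∫ u, ⟪f, u - ϕT z⟫ * ⟪g, u - ϕT z⟫ ∂(κ z) = ⟪f, Kφ g⟫) := by
  have hG : IsGaussian μ := hμ.isGaussian
  have hmem (f : X) : MemLp (fun u => ⟪f, u⟫) 2 μ :=
    hG.memLp_dual μ (innerSL ℝ f) 2 (by simp)
  have hrep (i : Fin N) (u : X) : φ i u = ⟪(InnerProductSpace.toDual ℝ X).symm (φ i), u⟫ := by
    simp
  have hKsymm (f g : X) : ⟪K f, g⟫ = ⟪f, K g⟫ := by
    rw [real_inner_comm (K g) f, hK, hK]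
    simp_rw [mul_comm]
  -- the covariances of the observations with linear functionals
  have hcovφ (i : Fin N) (f : X) : ∫ u, φ i u * ⟪f, u⟫ ∂μ = ⟪θ i, f⟫ := by
    simp_rw [hrep, hθ, hK]
  have hinvθ (i : Fin N) (f : X) : ∑ j, ⟪f, ϕ j⟫ * Θ i j = ⟪f, θ i⟫ := by
    have hΘθ : ∑ j, Θ i j • ϕ j = θ i := by
      simp_rw [hϕ, Finset.smul_sum, smul_smul]
      rw [Finset.sum_comm]
      simp_rw [← Finset.sum_smul, ← Matrix.mul_apply, Matrix.mul_nonsing_inv Θ hΘinv,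
        Matrix.one_apply, ite_smul, one_smul, zero_smul]
      simp
    rw [← hΘθ, inner_sum]
    simp_rw [inner_smul_right, mul_comm]
  let ΦL : X →L[ℝ] EuclideanSpace ℝ (Fin N) :=
    (EuclideanSpace.equiv (Fin N) ℝ).symm.toContinuousLinearMap ∘L ContinuousLinearMap.pi φ
  have hΦL : Φ = ΦL := by
    ext u i
    simp [hΦ, ΦL]
  let TL : EuclideanSpace ℝ (Fin N) →L[ℝ] X :=
    ∑ i, (EuclideanSpace.proj i : EuclideanSpace ℝ (Fin N) →L[ℝ] ℝ).smulRight (ϕ i)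
  have hTL : ϕT = TL := by
    ext z
    simp [hϕT, TL]
  let RL : X →L[ℝ] X := ContinuousLinearMap.id ℝ X - TL ∘L ΦL
  have hinnerR (f u : X) : ⟪f, RL u⟫ = ⟪f, u⟫ - ∑ j, ⟪f, ϕ j⟫ * φ j u := by
    have : RL u = u - ∑ j, φ j u • ϕ j := by simp [RL, ← hTL, ← hΦL, hϕT, hΦ]
    rw [this, inner_sub_right, inner_sum]
    simp_rw [inner_smul_right, mul_comm]
  have hmemφ (i : Fin N) : MemLp (fun u => φ i u) 2 μ := hG.memLp_dual μ (φ i) 2 (by simp)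
  have hmemR (f : X) : MemLp (fun u => ⟪f, RL u⟫) 2 μ :=
    hG.memLp_dual μ (innerSL ℝ f ∘L RL) 2 (by simp)
  have hmeanR (f : X) : ∫ u, ⟪f, RL u⟫ ∂μ = 0 := hμ.integral_dual (innerSL ℝ f ∘L RL)
  -- pairing any square-integrable variable with the residual
  have hpair {h : X → ℝ} (hh : MemLp h 2 μ) (f : X) :
      ∫ u, h u * ⟪f, RL u⟫ ∂μ = ∫ u, h u * ⟪f, u⟫ ∂μ - ∑ j, ⟪f, ϕ j⟫ * ∫ u, h u * φ j u ∂μ := by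
    have hInt (j : Fin N) : Integrable (fun u => ⟪f, ϕ j⟫ * (h u * φ j u)) μ :=
      (hh.integrable_mul (hmemφ j)).const_mul _
    simp_rw [hinnerR, mul_sub, Finset.mul_sum, mul_left_comm (h _)]
    have hhf : Integrable (fun u => h u * ⟪f, u⟫) μ := hh.integrable_mul (hmem f)
    rw [integral_sub hhf (integrable_finsetSum _ fun j _ => hInt j),
      integral_finsetSum _ fun j _ => hInt j]
    simp_rw [integral_const_mul]
  have horth (i : Fin N) (f : X) : ∫ u, φ i u * ⟪f, RL u⟫ ∂μ = 0 := by
    have hΘcov (j : Fin N) : ∫ u, φ i u * φ j u ∂μ = Θ i j := by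
      simp_rw [hrep j, hcovφ, hΘdef, hrep i, hθ, hKsymm]
    rw [hpair (hmemφ i), hcovφ]
    simp_rw [hΘcov]
    rw [hinvθ, real_inner_comm, sub_self]
  have hcovR (f g : X) : ∫ u, ⟪f, RL u⟫ * ⟪g, RL u⟫ ∂μ = ⟪f, Kφ g⟫ := by
    have hzero (j : Fin N) : ∫ u, ⟪g, RL u⟫ * φ j u ∂μ = 0 := by
      simpa only [mul_comm] using horth j g
    have hcov (j : Fin N) : ∫ u, ⟪f, u⟫ * φ j u ∂μ = ⟪θ j, f⟫ := by
      simpa only [mul_comm] using hcovφ j f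
    calc ∫ u, ⟪f, RL u⟫ * ⟪g, RL u⟫ ∂μ = ∫ u, ⟪g, RL u⟫ * ⟪f, RL u⟫ ∂μ := by
          simp_rw [mul_comm]
      _ = ∫ u, ⟪g, RL u⟫ * ⟪f, u⟫ ∂μ := by
          rw [hpair (hmemR g) f]
          simp [hzero]
      _ = ∫ u, ⟪f, u⟫ * ⟪g, RL u⟫ ∂μ := by simp_rw [mul_comm]
      _ = ⟪K f, g⟫ - ∑ i, ⟪g, ϕ i⟫ * ⟪θ i, f⟫ := by
          rw [hpair (hmem f) g, ← hK]
          simp_rw [hcov]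
      _ = ⟪f, Kφ g⟫ := by
          rw [hKφ, inner_sub_right, hKsymm, inner_sum]
          congr 1
          refine Finset.sum_congr rfl fun i _ => ?_
          rw [hϕ, inner_sum, inner_sum, Finset.sum_mul]
          refine Finset.sum_congr rfl fun j _ => ?_
          rw [inner_smul_right, inner_smul_right, real_inner_comm g, real_inner_comm f]
  have hind : IndepFun Φ RL μ := by
    rw [hΦL]
    have hlaw : HasGaussianLaw (fun u => (ΦL u, RL u)) μ :=
      IsGaussian.hasGaussianLaw_id.map_fun (ΦL.prod RL)
    refine hlaw.indepFun_of_covariance_inner fun x y => ?_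
    have hx : (fun u => ⟪x, ΦL u⟫) = fun u => ∑ i, x i * φ i u := by
      ext u
      simp [← hΦL, PiLp.inner_apply, hΦ, mul_comm]
    have hmx : MemLp (fun u => ⟪x, ΦL u⟫) 2 μ :=
      hG.memLp_dual μ (innerSL ℝ x ∘L ΦL) 2 (by simp)
    rw [covariance_eq_sub hmx (hmemR y), hmeanR, mul_zero, sub_zero, hx]
    simp only [Pi.mul_apply, Finset.sum_mul, mul_assoc]
    have hInt (i : Fin N) : Integrable (fun u => x i * (φ i u * ⟪y, RL u⟫)) μ :=
      ((hmemφ i).integrable_mul (hmemR y)).const_mul _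
    rw [integral_finsetSum _ fun i _ => hInt i]
    simp [integral_const_mul, horth]
  have hdecomp (u : X) : ϕT (Φ u) + RL u = u := by simp [RL, hTL, hΦL]
  let ker : Kernel (EuclideanSpace ℝ (Fin N)) X :=
    ⟨κ, Measure.measurable_of_measurable_coe _ hκmeas⟩
  have hkerprob : IsMarkovKernel ker := ⟨hκprob⟩
  have hν : IsGaussian (μ.map RL) := inferInstance
  have hae := ae_eq_map_add_of_indepFun (T := ϕT) (by rw [hΦL]; fun_prop)
    RL.continuous.measurable (by rw [hTL]; fun_prop) hdecomp hind ker (hρ ▸ hκ)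
  filter_upwards [hae] with z hz
  replace hz : κ z = (μ.map RL).map (ϕT z + ·) := hz
  have hmap : κ z = μ.map (fun u => ϕT z + RL u) := by
    rw [hz, Measure.map_map (by fun_prop) (by fun_prop)]
    rfl
  have hmeas : AEMeasurable (fun u => ϕT z + RL u) μ := by fun_prop
  have hκG : IsGaussian (κ z) := by rw [hz]; infer_instance
  refine ⟨fun f => ⟨_, _, hκG.map_eq_gaussianReal f⟩, fun f => ?_, fun f g => ?_⟩
  · rw [hmap, integral_map hmeas (by fun_prop)]
    simp_rw [inner_add_right]
    rw [integral_add (integrable_const _) ((hmemR f).integrable one_le_two), hmeanR]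
    simp
  · rw [hmap, integral_map hmeas (by fun_prop)]
    simpa using hcovR f g

end
end

section
/- Under μ, the X-valued random variables u ↦ u − ϕᵀφ(u) and u ↦ ϕᵀφ(u) are independent; the law μ^φ of u ↦ u − ϕᵀφ(u) under μ is a centered Gaussian measure on X whose covariance operator is K^φ; and μ = μ^φ ∗ (ϕᵀ)_♯η, where η = φ_♯μ. -/
open MeasureTheory ProbabilityTheory Filter Topology Metric
open scoped ENNReal NNReal RealInnerProductSpace

noncomputable section

section Covariance

variable {X : Type*} [NormedAddCommGroup X] [InnerProductSpace ℝ X]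
  [MeasurableSpace X] {μ : Measure X} {K : X →L[ℝ] X}

lemma integral_inner_mul_inner_comp [CompleteSpace X]
    (hK : ∀ f g : X, ⟪K f, g⟫ = ∫ u, ⟪f, u⟫ * ⟪g, u⟫ ∂μ) (A B : X →L[ℝ] X) (f g : X) :
    ∫ u, ⟪f, A u⟫ * ⟪g, B u⟫ ∂μ = ⟪B (K (A.adjoint f)), g⟫ := by
  rw [← ContinuousLinearMap.adjoint_inner_right, hK]
  simp_rw [ContinuousLinearMap.adjoint_inner_left]

variable [BorelSpace X]

lemma IsCenteredGaussian.isGaussian_s3 (hμ : IsCenteredGaussian μ) : IsGaussian μ :=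
  isGaussian_of_map_eq_gaussianReal fun L => ⟨0, hμ L⟩

lemma IsCenteredGaussian.integral_dual_eq_zero (hμ : IsCenteredGaussian μ) (L : X →L[ℝ] ℝ) :
    ∫ u, L u ∂μ = 0 := by
  obtain ⟨v, hv⟩ := hμ L
  have h : ∫ x, x ∂(μ.map L) = ∫ u, L u ∂μ := integral_map (by fun_prop) (by fun_prop)
  rw [← h, hv, integral_id_gaussianReal]

lemma IsCenteredGaussian.map (hμ : IsCenteredGaussian μ) (T : X →L[ℝ] X) :
    IsCenteredGaussian (μ.map T) := by
  intro f
  obtain ⟨v, hv⟩ := hμ (f ∘L T)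
  exact ⟨v, by rw [Measure.map_map (by fun_prop) (by fun_prop), ← hv]; rfl⟩

/-- Uncorrelated linear images of a centered Gaussian measure are independent. -/
lemma IsCenteredGaussian.indepFun_of_comp_adjoint_eq_zero [CompleteSpace X]
    [SecondCountableTopology X] (hμ : IsCenteredGaussian μ)
    (hK : ∀ f g : X, ⟪K f, g⟫ = ∫ u, ⟪f, u⟫ * ⟪g, u⟫ ∂μ) (A B : X →L[ℝ] X)
    (hAB : ∀ f, B (K (A.adjoint f)) = 0) : IndepFun A B μ := by
  have := hμ.isGaussian_s3
  have hlaw : HasGaussianLaw (fun u => (A u, B u)) μ :=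
    IsGaussian.hasGaussianLaw_id.map_fun (A.prod B)
  refine hlaw.indepFun_of_covariance_inner fun f g => ?_
  have hA : MemLp (fun u => ⟪f, A u⟫) 2 μ :=
    IsGaussian.memLp_dual μ (innerSL ℝ f ∘L A) 2 (by simp)
  have hB : MemLp (fun u => ⟪g, B u⟫) 2 μ :=
    IsGaussian.memLp_dual μ (innerSL ℝ g ∘L B) 2 (by simp)
  have h0 : ∫ u, ⟪f, A u⟫ ∂μ = 0 := hμ.integral_dual_eq_zero (innerSL ℝ f ∘L A)
  have hint := integral_inner_mul_inner_comp hK A B f g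
  rw [hAB, inner_zero_left] at hint
  rw [covariance_eq_sub hA hB, h0, zero_mul, sub_zero]
  exact hint

end Covariance

theorem statement_3
    {X : Type*} [NormedAddCommGroup X] [InnerProductSpace ℝ X] [CompleteSpace X]
    [SecondCountableTopology X] [MeasurableSpace X] [BorelSpace X]
    {N : ℕ}
    (μ : Measure X) [IsProbabilityMeasure μ] (hμ : IsCenteredGaussian μ)
    (K : X →L[ℝ] X)
    (hK : ∀ f g : X, ⟪K f, g⟫ = ∫ u, ⟪f, u⟫ * ⟪g, u⟫ ∂μ)
    (φ : Fin N → (X →L[ℝ] ℝ))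
    -- the map `φ = (φ₁, …, φ_N) : X → ℝ^N`
    (Φ : X → EuclideanSpace ℝ (Fin N))
    (hΦ : ∀ u i, Φ u i = φ i u)
    -- `θᵢ = K φᵢ*`, where `φᵢ*` is the Riesz representer of `φᵢ`
    (θ : Fin N → X)
    (hθ : ∀ i, θ i = K ((InnerProductSpace.toDual ℝ X).symm (φ i)))
    -- the Gram matrix `Θᵢⱼ = φᵢ(K φⱼ*)`, assumed invertible
    (Θ : Matrix (Fin N) (Fin N) ℝ)
    (hΘdef : ∀ i j, Θ i j = φ i (θ j))
    (hΘinv : IsUnit Θ.det)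
    -- the gamblets `ϕᵢ = Σⱼ (Θ⁻¹)ᵢⱼ θⱼ` and the reconstruction map `ϕᵀ`
    (ϕ : Fin N → X)
    (hϕ : ∀ i, ϕ i = ∑ j, Θ⁻¹ i j • θ j)
    (ϕT : EuclideanSpace ℝ (Fin N) → X)
    (hϕT : ∀ z, ϕT z = ∑ i, z i • ϕ i)
    -- the conditional covariance operator `K^φ`
    (Kφ : X → X)
    (hKφ : ∀ f, Kφ f = K f - ∑ i, ∑ j, (Θ⁻¹ i j * ⟪θ j, f⟫) • θ i)
    -- `μ^φ`, the law of `u ↦ u - ϕᵀ φ(u)` under `μ`, and `η = φ_♯ μ`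
    (μφ : Measure X)
    (hμφ : μφ = μ.map fun u => u - ϕT (Φ u))
    (η : Measure (EuclideanSpace ℝ (Fin N)))
    (hη : η = μ.map Φ) :
    IndepFun (fun u => u - ϕT (Φ u)) (fun u => ϕT (Φ u)) μ ∧
    IsCenteredGaussian μφ ∧
    (∀ f g : X, ⟪Kφ f, g⟫ = ∫ u, ⟪f, u⟫ * ⟪g, u⟫ ∂μφ) ∧
    μ = μφ.conv (η.map ϕT) := by
  have hsymm : ∀ f g : X, ⟪K f, g⟫ = ⟪f, K g⟫ := fun f g => by
    rw [real_inner_comm (K g) f, hK, hK]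
    simp_rw [mul_comm]
  have hφθ : ∀ i f, φ i (K f) = ⟪θ i, f⟫ := fun i f => by
    rw [hθ, hsymm, InnerProductSpace.toDual_symm_apply]
  have hΘsymm : Θ.transpose = Θ := by
    ext i j
    rw [Matrix.transpose_apply, hΘdef, hΘdef, hθ i, hθ j, hφθ, hφθ, hθ i, hθ j, hsymm,
      real_inner_comm, hsymm]
  have hΘinv_symm : ∀ i j, Θ⁻¹ i j = Θ⁻¹ j i := fun i j => by
    rw [← Matrix.transpose_apply Θ⁻¹, Matrix.transpose_nonsing_inv, hΘsymm]
  have hdual : ∀ i j, φ i (ϕ j) = if i = j then 1 else 0 := fun i j => by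
    rw [← Matrix.one_apply, ← Matrix.mul_nonsing_inv Θ hΘinv, Matrix.mul_apply, hϕ, map_sum]
    refine Finset.sum_congr rfl fun k _ => ?_
    rw [map_smul, smul_eq_mul, ← hΘdef, hΘinv_symm j k, mul_comm]
  let P : X →L[ℝ] X := ∑ i, (φ i).smulRight (ϕ i)
  have hP : ∀ u, P u = ∑ i, φ i u • ϕ i := fun u => by simp [P]
  have hPeq : ∀ u, ϕT (Φ u) = P u := fun u => by simp_rw [hP, hϕT, hΦ]
  have hPP : ∀ u, P (P u) = P u := fun u => by
    rw [hP (P u), hP u]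
    simp [hdual]
  have hPadj : ∀ f, P.adjoint f = ∑ i, ⟪ϕ i, f⟫ • (InnerProductSpace.toDual ℝ X).symm (φ i) :=
    fun f => ext_inner_right ℝ fun u => by
      rw [ContinuousLinearMap.adjoint_inner_left, hP, inner_sum, sum_inner]
      refine Finset.sum_congr rfl fun i _ => ?_
      rw [real_inner_smul_left, real_inner_smul_right, InnerProductSpace.toDual_symm_apply,
        real_inner_comm, mul_comm]
  have hKadj : ∀ f, K (P.adjoint f) = ∑ i, ∑ j, (Θ⁻¹ i j * ⟪θ j, f⟫) • θ i := fun f => by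
    rw [hPadj, map_sum]
    refine Finset.sum_congr rfl fun i _ => ?_
    rw [map_smul, ← hθ, hϕ, sum_inner, Finset.sum_smul]
    simp_rw [real_inner_smul_left]
  have hPK : ∀ f, P (K f) = K (P.adjoint f) := fun f => by
    rw [hP, hKadj, Finset.sum_comm]
    refine Finset.sum_congr rfl fun j _ => ?_
    rw [hφθ, hϕ, Finset.smul_sum]
    refine Finset.sum_congr rfl fun i _ => ?_
    rw [smul_smul, hΘinv_symm j i, mul_comm]
  let T : X →L[ℝ] X := ContinuousLinearMap.id ℝ X - P
  have hT : ∀ u, T u = u - P u := fun u => rfl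
  have hKT : ∀ f, K (T.adjoint f) = Kφ f := fun f => by
    have hTadj : T.adjoint f = f - P.adjoint f := ext_inner_right ℝ fun u => by
      rw [ContinuousLinearMap.adjoint_inner_left, hT, inner_sub_left, inner_sub_right,
        ContinuousLinearMap.adjoint_inner_left]
    rw [hTadj, map_sub, hKadj, hKφ]
  have hPKφ : ∀ f, P (Kφ f) = 0 := fun f => by
    rw [hKφ, ← hKadj, map_sub, ← hPK, hPP, sub_self]
  have hμφT : μφ = μ.map T := by
    rw [hμφ]
    simp_rw [hPeq]
    rfl
  have hΦmeas : Measurable Φ := by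
    have hΦ' : Φ = fun u => WithLp.toLp 2 fun i => φ i u := by
      ext u i
      exact hΦ u i
    rw [hΦ']
    fun_prop
  have hϕTmeas : Measurable ϕT := by
    rw [funext hϕT]
    fun_prop
  have hηP : η.map ϕT = μ.map P := by
    rw [hη, Measure.map_map hϕTmeas hΦmeas]
    exact congrArg (fun F => μ.map F) (funext hPeq)
  have hindep : IndepFun T P μ :=
    hμ.indepFun_of_comp_adjoint_eq_zero hK T P fun f => by rw [hKT, hPKφ]
  refine ⟨?_, ?_, fun f g => ?_, ?_⟩
  · simp_rw [hPeq]
    exact hindep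
  · rw [hμφT]
    exact hμ.map T
  · rw [hμφT, integral_map (by fun_prop) (by fun_prop), integral_inner_mul_inner_comp hK, hKT,
      hT, hPKφ, sub_zero]
  · have hsum : ⇑T + ⇑P = id := funext fun u => sub_add_cancel u (P u)
    rw [hμφT, hηP, ← hindep.map_add_eq_map_conv_map₀ (by fun_prop) (by fun_prop), hsum,
      Measure.map_id]

end
end

section
/- For every β > 0 and y ∈ ℝ^M, the quantity ϖ_β(y) := ∫_{ℝ^N} exp(−|F(z)−y|²/(2β²) − ½ zᵀΘ⁻¹z) dz (integral with respect to Lebesgue measure) is finite and strictly positive, and, with η^y_β the probability measure on ℝ^N whose Lebesgue density is z ↦ ϖ_β(y)⁻¹ exp(−|F(z)−y|²/(2β²) − ½ zᵀΘ⁻¹z), the posterior decomposes as μ^y_β = μ^φ ∗ (ϕᵀ)_♯ η^y_β. -/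
open MeasureTheory ProbabilityTheory Filter Topology Metric
open scoped ENNReal NNReal RealInnerProductSpace

noncomputable section

theorem map_withDensity_comp {α β : Type*} [MeasurableSpace α] [MeasurableSpace β]
    (μ : Measure α) {g : α → β} (hg : Measurable g) {h : β → ℝ≥0∞} (hh : Measurable h) :
    (μ.withDensity (h ∘ g)).map g = (μ.map g).withDensity h := by
  ext s hs
  rw [Measure.map_apply hg hs, withDensity_apply _ (hg hs), withDensity_apply _ hs,
    setLIntegral_map hs hh hg]
  rfl

/-- If `u = R u + T (Φ u)` with `R` and `Φ` independent, then reweighting `μ` by a density that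
depends on `Φ` only amounts to reweighting the law of `Φ` in the convolution. -/
theorem withDensity_comp_eq_conv {X E : Type*} [AddMonoid X] [MeasurableSpace X]
    [MeasurableAdd₂ X] [MeasurableSpace E] {μ : Measure X} [IsProbabilityMeasure μ]
    {R : X → X} {Φ : X → E} {T : E → X} (hR : Measurable R) (hΦ : Measurable Φ)
    (hT : Measurable T) (hind : IndepFun R Φ μ) (hsum : ∀ u, R u + T (Φ u) = u)
    {h : E → ℝ≥0∞} (hh : Measurable h) [SFinite ((μ.map Φ).withDensity h)] :
    μ.withDensity (h ∘ Φ) = (μ.map R).conv (((μ.map Φ).withDensity h).map T) := by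
  have := Measure.isProbabilityMeasure_map (μ := μ) hR.aemeasurable
  have := Measure.isProbabilityMeasure_map (μ := μ) hΦ.aemeasurable
  have hpair : Measurable fun u => (R u, Φ u) := hR.prodMk hΦ
  have hmap := (indepFun_iff_map_prod_eq_prod_map_map hR.aemeasurable hΦ.aemeasurable).1 hind
  have hid : (fun p : X × X => p.1 + p.2) ∘ Prod.map id T ∘ (fun u => (R u, Φ u)) = id := by
    ext u; exact hsum u
  have hprod : (μ.map R).prod (((μ.map Φ).withDensity h).map T) =
      (μ.withDensity (h ∘ Φ)).map (Prod.map id T ∘ fun u => (R u, Φ u)) := by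
    rw [← Measure.map_map (by fun_prop) hpair,
      show h ∘ Φ = (h ∘ Prod.snd) ∘ fun u => (R u, Φ u) from rfl,
      map_withDensity_comp _ hpair (hh.comp measurable_snd), hmap]
    conv_lhs => rw [← Measure.map_id (μ := μ.map R)]
    rw [Measure.map_prod_map _ _ measurable_id hT, prod_withDensity_right hh]
    rfl
  rw [Measure.conv, hprod, Measure.map_map (by fun_prop) (by fun_prop), hid, Measure.map_id]

section GaussianDensity

variable {E : Type*} [NormedAddCommGroup E] [InnerProductSpace ℝ E] [FiniteDimensional ℝ E]
  [MeasurableSpace E] [BorelSpace E]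

theorem integrable_exp_neg_half_sq_norm :
    Integrable fun x : E => Real.exp (-(1 / 2) * ‖x‖ ^ 2) := by
  have := (GaussianFourier.integrable_cexp_neg_mul_sq_norm_add (V := E) (b := (1 / 2 : ℂ))
    (by norm_num) 0 0).norm
  refine this.congr (ae_of_all _ fun x => ?_)
  simp only [Complex.norm_exp]
  congr 1
  simp [← Complex.ofReal_pow]

theorem stdGaussian_eq_withDensity :
    ∃ c : ℝ, 0 < c ∧ stdGaussian E =
      volume.withDensity fun x => ENNReal.ofReal (c * Real.exp (-(1 / 2) * ‖x‖ ^ 2)) := by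
  set I : ℝ := ∫ x : E, Real.exp (-(1 / 2) * ‖x‖ ^ 2) with hI
  have hint := integrable_exp_neg_half_sq_norm (E := E)
  have hIpos : 0 < I := integral_exp_pos hint
  refine ⟨I⁻¹, inv_pos.2 hIpos, ?_⟩
  have : IsFiniteMeasure ((volume : Measure E).withDensity
      fun x => ENNReal.ofReal (I⁻¹ * Real.exp (-(1 / 2) * ‖x‖ ^ 2))) :=
    isFiniteMeasure_withDensity_ofReal (hint.const_mul _).2
  refine Measure.ext_of_charFun ?_
  ext t
  have hIC : (I : ℂ) = (Real.pi / (1 / 2 : ℂ)) ^ (Module.finrank ℝ E / 2 : ℂ) := by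
    rw [← GaussianFourier.integral_cexp_neg_mul_sq_norm (V := E) (b := (1 / 2 : ℂ)) (by norm_num),
      hI, ← integral_complex_ofReal]
    push_cast
    rfl
  rw [charFun_stdGaussian, charFun_apply, integral_withDensity_eq_integral_toReal_smul
    (by fun_prop) (ae_of_all _ fun x => ENNReal.ofReal_lt_top)]
  have key := GaussianFourier.integral_cexp_neg_mul_sq_norm_add (V := E) (b := (1 / 2 : ℂ))
    (by norm_num) Complex.I t
  rw [← hIC] at key
  have hne : (I : ℂ) ≠ 0 := by exact_mod_cast hIpos.ne'
  calc Complex.exp (-‖t‖ ^ 2 / 2)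
      = (I : ℂ)⁻¹ * (I * Complex.exp (Complex.I ^ 2 * ‖t‖ ^ 2 / (4 * (1 / 2)))) := by
        rw [inv_mul_cancel_left₀ hne, Complex.I_sq]
        congr 1
        ring
    _ = _ := by
        rw [← key, ← integral_const_mul]
        congr 1
        ext x
        rw [ENNReal.toReal_ofReal (by positivity), Complex.real_smul, Complex.exp_add,
          real_inner_comm]
        push_cast
        rw [mul_comm Complex.I]
        ring

end GaussianDensity

open scoped MatrixOrder in
theorem multivariateGaussian_eq_withDensity {ι : Type*} [Fintype ι] [DecidableEq ι]
    {S : Matrix ι ι ℝ} (hS : S.PosDef) :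
    ∃ c : ℝ, 0 < c ∧ multivariateGaussian 0 S = volume.withDensity fun z =>
      ENNReal.ofReal (c * Real.exp (-(1 / 2) * ∑ i, ∑ j, z i * S⁻¹ i j * z j)) := by
  obtain ⟨c, hc, hstd⟩ := stdGaussian_eq_withDensity (E := EuclideanSpace ℝ ι)
  set A : Matrix ι ι ℝ := CFC.sqrt S with hA
  set B : Matrix ι ι ℝ := CFC.sqrt S⁻¹ with hB
  have hBA : B = A⁻¹ := hS.posSemidef.inv_sqrt.symm
  have hAA : A * A = S := CFC.sqrt_mul_sqrt_self _ hS.posSemidef.nonneg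
  have hBB : B * B = S⁻¹ := CFC.sqrt_mul_sqrt_self _ hS.inv.posSemidef.nonneg
  have hBT : B.transpose = B := by
    have := (CFC.sqrt_nonneg S⁻¹).isSelfAdjoint
    rw [← hB] at this
    simpa using! this
  have hAu : IsUnit A.det := by
    have := hS.det_pos.ne'
    rw [← hAA, Matrix.det_mul] at this
    exact (left_ne_zero_of_mul this).isUnit
  set a := Matrix.toEuclideanCLM (𝕜 := ℝ) A with ha
  set b := Matrix.toEuclideanCLM (𝕜 := ℝ) B with hb
  have hba : b * a = 1 := by rw [ha, hb, ← map_mul, hBA, Matrix.nonsing_inv_mul _ hAu, map_one]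
  have hba' : ∀ x, b (a x) = x := fun x => congrArg (fun f => f x) hba
  have hdet : LinearMap.det (a : EuclideanSpace ℝ ι →ₗ[ℝ] EuclideanSpace ℝ ι) ≠ 0 := by
    intro h0
    have h1 := congrArg (fun f : EuclideanSpace ℝ ι →L[ℝ] EuclideanSpace ℝ ι =>
      LinearMap.det (f : EuclideanSpace ℝ ι →ₗ[ℝ] EuclideanSpace ℝ ι)) hba
    have h2 : ((b * a : EuclideanSpace ℝ ι →L[ℝ] EuclideanSpace ℝ ι) :
        EuclideanSpace ℝ ι →ₗ[ℝ] EuclideanSpace ℝ ι) = (b : _ →ₗ[ℝ] _) * (a : _ →ₗ[ℝ] _) := rfl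
    simp only [h2, map_mul, h0, mul_zero] at h1
    have h3 : LinearMap.det ((1 : EuclideanSpace ℝ ι →L[ℝ] EuclideanSpace ℝ ι) :
        EuclideanSpace ℝ ι →ₗ[ℝ] EuclideanSpace ℝ ι) = 1 := LinearMap.det_id
    rw [h3] at h1
    exact zero_ne_one h1
  have hnorm : ∀ z, ‖b z‖ ^ 2 = ∑ i, ∑ j, z i * S⁻¹ i j * z j := by
    intro z
    rw [← real_inner_self_eq_norm_sq, hb, Matrix.inner_toEuclideanCLM, Matrix.ofLp_toEuclideanCLM,
      Matrix.dotProduct_mulVec, ← Matrix.mulVec_transpose, Matrix.mulVec_mulVec, hBT, hBB,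
      dotProduct_comm]
    simp only [dotProduct, Matrix.mulVec, Finset.mul_sum, mul_assoc]
  set k : ℝ := |(LinearMap.det (a : EuclideanSpace ℝ ι →ₗ[ℝ] EuclideanSpace ℝ ι))⁻¹| with hk
  have hkpos : 0 < k := abs_pos.2 (inv_ne_zero hdet)
  refine ⟨k * c, mul_pos hkpos hc, ?_⟩
  have hmap : (volume : Measure (EuclideanSpace ℝ ι)).map a = ENNReal.ofReal k • volume :=
    Measure.map_linearMap_addHaar_eq_smul_addHaar _ hdet
  have hmeas : Measurable fun z : EuclideanSpace ℝ ι =>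
      ENNReal.ofReal (c * Real.exp (-(1 / 2) * ‖b z‖ ^ 2)) := by fun_prop
  have hcomp : (fun x : EuclideanSpace ℝ ι => ENNReal.ofReal (c * Real.exp (-(1 / 2) * ‖x‖ ^ 2))) =
      (fun z => ENNReal.ofReal (c * Real.exp (-(1 / 2) * ‖b z‖ ^ 2))) ∘ a := by
    ext x
    simp [hba']
  have hmg : multivariateGaussian 0 S = (stdGaussian (EuclideanSpace ℝ ι)).map a := by
    simp only [multivariateGaussian, zero_add]
    rfl
  rw [hmg, hstd, hcomp, map_withDensity_comp _ (by fun_prop) hmeas, hmap, withDensity_smul_measure,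
    ← withDensity_smul _ hmeas]
  congr 1
  ext z
  simp only [Pi.smul_apply, smul_eq_mul, hnorm, mul_assoc]
  rw [← ENNReal.ofReal_mul hkpos.le]

theorem withDensity_normalized_eq {E : Type*} [MeasurableSpace E] {P ν : Measure E}
    [IsProbabilityMeasure P] {c : ℝ} (hc : 0 < c) {e g : E → ℝ} (hem : Measurable e)
    (hgm : Measurable g) (he0 : ∀ z, 0 < e z) (he1 : ∀ z, e z ≤ 1) (hg0 : ∀ z, 0 < g z)
    (hP : P = ν.withDensity fun z => ENNReal.ofReal (c * g z)) :
    Integrable (fun z => e z * g z) ν ∧ 0 < ∫ z, e z * g z ∂ν ∧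
      P.withDensity (fun z => ENNReal.ofReal ((∫ x, e x ∂P)⁻¹ * e z)) =
        ν.withDensity fun z => ENNReal.ofReal ((∫ x, e x * g x ∂ν)⁻¹ * (e z * g z)) := by
  have hcg : Measurable fun z => ENNReal.ofReal (c * g z) := by fun_prop
  have hgint : Integrable g ν := by
    have h1 : ∫⁻ z, ENNReal.ofReal (c * g z) ∂ν = 1 := by
      rw [← setLIntegral_univ, ← withDensity_apply _ MeasurableSet.univ, ← hP, measure_univ]
    have h2 : Integrable (fun z => c * g z) ν :=
      ⟨by fun_prop, by
        rw [hasFiniteIntegral_iff_ofReal (ae_of_all _ fun z => (mul_pos hc (hg0 z)).le), h1]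
        exact ENNReal.one_lt_top⟩
    simpa [← mul_assoc, inv_mul_cancel₀ hc.ne'] using h2.const_mul c⁻¹
  have hint : Integrable (fun z => e z * g z) ν :=
    hgint.mono' (by fun_prop) (ae_of_all _ fun z => by
      rw [Real.norm_of_nonneg (mul_pos (he0 z) (hg0 z)).le]
      exact mul_le_of_le_one_left (hg0 z).le (he1 z))
  have hν : ν ≠ 0 := by
    rintro rfl
    rw [withDensity_zero_left] at hP
    exact IsProbabilityMeasure.ne_zero P hP
  have hpos : 0 < ∫ z, e z * g z ∂ν := by
    rw [integral_pos_iff_support_of_nonneg (fun z => (mul_pos (he0 z) (hg0 z)).le) hint,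
      Function.support_eq_univ fun z => (mul_pos (he0 z) (hg0 z)).ne']
    exact Measure.measure_univ_pos.2 hν
  have hω : ∫ x, e x ∂P = c * ∫ z, e z * g z ∂ν := by
    rw [hP, integral_withDensity_eq_integral_toReal_smul hcg
      (ae_of_all _ fun x => ENNReal.ofReal_lt_top), ← integral_const_mul]
    congr 1
    ext z
    rw [ENNReal.toReal_ofReal (mul_pos hc (hg0 z)).le, smul_eq_mul]
    ring
  refine ⟨hint, hpos, ?_⟩
  rw [hω, hP, ← withDensity_mul _ hcg (by fun_prop)]
  congr 1
  ext z
  rw [Pi.mul_apply, ← ENNReal.ofReal_mul (mul_pos hc (hg0 z)).le]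
  congr 1
  field_simp

namespace IsCenteredGaussian

variable {X : Type*} [NormedAddCommGroup X] [InnerProductSpace ℝ X] [MeasurableSpace X]
  [BorelSpace X] {μ : Measure X}

theorem isGaussian_s5 (hμ : IsCenteredGaussian μ) : IsGaussian μ :=
  isGaussian_of_map_eq_gaussianReal fun L => ⟨0, hμ L⟩

theorem integral_inner_eq_zero (hμ : IsCenteredGaussian μ) (f : X) : ∫ u, ⟪f, u⟫ ∂μ = 0 := by
  obtain ⟨v, hv⟩ := hμ (innerSL ℝ f)
  have := integral_map (μ := μ) (φ := innerSL ℝ f) (f := fun x : ℝ => x) (by fun_prop)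
    (by fun_prop)
  rw [hv, integral_id_gaussianReal] at this
  simpa using this.symm

theorem covariance_inner {K : X →L[ℝ] X}
    (hK : ∀ f g : X, ⟪K f, g⟫ = ∫ u, ⟪f, u⟫ * ⟪g, u⟫ ∂μ)
    (hμ : IsCenteredGaussian μ) (f g : X) :
    cov[fun u => ⟪f, u⟫, fun u => ⟪g, u⟫; μ] = ⟪K f, g⟫ := by
  have := hμ.isGaussian_s5
  have hL : ∀ f : X, MemLp (fun u => ⟪f, u⟫) 2 μ := fun f =>
    IsGaussian.memLp_dual μ (innerSL ℝ f) 2 (by simp)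
  rw [covariance_eq_sub (hL f) (hL g), hμ.integral_inner_eq_zero, zero_mul, sub_zero, hK]
  rfl

variable [CompleteSpace X]

theorem indepFun_of_comp_eq_zero [SecondCountableTopology X] {K : X →L[ℝ] X}
    (hK : ∀ f g : X, ⟪K f, g⟫ = ∫ u, ⟪f, u⟫ * ⟪g, u⟫ ∂μ)
    {E : Type*} [NormedAddCommGroup E] [InnerProductSpace ℝ E]
    [FiniteDimensional ℝ E] [MeasurableSpace E] [BorelSpace E] (hμ : IsCenteredGaussian μ)
    (R : X →L[ℝ] X) (W : X →L[ℝ] E) (h : ∀ t, R (K (W.adjoint t)) = 0) : IndepFun R W μ := by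
  have := hμ.isGaussian_s5
  have := FiniteDimensional.complete ℝ E
  have hlaw : HasGaussianLaw (fun u => (W u, R u)) μ :=
    (IsGaussian.hasGaussianLaw_id (μ := μ)).map_fun (W.prod R)
  refine (hlaw.indepFun_of_covariance_inner fun x y => ?_).symm
  simp only [← ContinuousLinearMap.adjoint_inner_left]
  rw [hμ.covariance_inner hK, ContinuousLinearMap.adjoint_inner_right, h, inner_zero_left]

theorem map_eq_multivariateGaussian {ι : Type*} [Fintype ι] [DecidableEq ι]
    {K : X →L[ℝ] X}
    (hK : ∀ f g : X, ⟪K f, g⟫ = ∫ u, ⟪f, u⟫ * ⟪g, u⟫ ∂μ)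
    (hμ : IsCenteredGaussian μ) (W : X →L[ℝ] EuclideanSpace ℝ ι) {S : Matrix ι ι ℝ}
    (hS : S.PosSemidef) (h : ∀ t, W (K (W.adjoint t)) = Matrix.toEuclideanCLM (𝕜 := ℝ) S t) :
    μ.map W = multivariateGaussian 0 S := by
  have := hμ.isGaussian_s5
  refine Measure.ext_of_charFun ?_
  ext t
  rw [charFun_multivariateGaussian hS, IsGaussian.charFun_eq,
    integral_map (by fun_prop) (by fun_prop), variance_map (by fun_prop) (by fun_prop),
    ← covariance_self (by fun_prop)]
  simp only [Function.comp_def, ← ContinuousLinearMap.adjoint_inner_left]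
  rw [hμ.covariance_inner hK, integral_complex_ofReal, hμ.integral_inner_eq_zero,
    ContinuousLinearMap.adjoint_inner_right, h, real_inner_comm, Matrix.inner_toEuclideanCLM]
  simp

end IsCenteredGaussian

theorem statement_5
    {X : Type*} [NormedAddCommGroup X] [InnerProductSpace ℝ X] [CompleteSpace X]
    [SecondCountableTopology X] [MeasurableSpace X] [BorelSpace X]
    {N M : ℕ}
    (μ : Measure X) [IsProbabilityMeasure μ] (hμ : IsCenteredGaussian μ)
    (K : X →L[ℝ] X)
    (hK : ∀ f g : X, ⟪K f, g⟫ = ∫ u, ⟪f, u⟫ * ⟪g, u⟫ ∂μ)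
    (φ : Fin N → (X →L[ℝ] ℝ))
    -- the map `φ = (φ₁, …, φ_N) : X → ℝ^N`
    (Φ : X → EuclideanSpace ℝ (Fin N))
    (hΦ : ∀ u i, Φ u i = φ i u)
    -- `θᵢ = K φᵢ*`, where `φᵢ*` is the Riesz representer of `φᵢ`
    (θ : Fin N → X)
    (hθ : ∀ i, θ i = K ((InnerProductSpace.toDual ℝ X).symm (φ i)))
    -- the Gram matrix `Θᵢⱼ = φᵢ(K φⱼ*)`, assumed invertible
    (Θ : Matrix (Fin N) (Fin N) ℝ)
    (hΘdef : ∀ i j, Θ i j = φ i (θ j))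
    (hΘinv : IsUnit Θ.det)
    -- the gamblets `ϕᵢ = Σⱼ (Θ⁻¹)ᵢⱼ θⱼ` and the reconstruction map `ϕᵀ`
    (ϕ : Fin N → X)
    (hϕ : ∀ i, ϕ i = ∑ j, Θ⁻¹ i j • θ j)
    (ϕT : EuclideanSpace ℝ (Fin N) → X)
    (hϕT : ∀ z, ϕT z = ∑ i, z i • ϕ i)
    -- `F` is locally Lipschitz
    (F : EuclideanSpace ℝ (Fin N) → EuclideanSpace ℝ (Fin M))
    (hF : ∀ r > (0 : ℝ), ∃ L : ℝ≥0, LipschitzOnWith L F (ball 0 r))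
    -- `μ^φ`, the law of `u ↦ u - ϕᵀ φ(u)` under `μ`
    (μφ : Measure X)
    (hμφ : μφ = μ.map fun u => u - ϕT (Φ u))
    -- the normalization constants `ω_β` and the posteriors `μ^y_β`
    (ω : ℝ → EuclideanSpace ℝ (Fin M) → ℝ)
    (hω : ∀ β > (0 : ℝ), ∀ y,
      ω β y = ∫ u, Real.exp (-‖F (Φ u) - y‖ ^ 2 / (2 * β ^ 2)) ∂μ)
    (post : ℝ → EuclideanSpace ℝ (Fin M) → Measure X)
    (hpost : ∀ β > (0 : ℝ), ∀ y, post β y = μ.withDensity fun u =>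
      ENNReal.ofReal ((ω β y)⁻¹ * Real.exp (-‖F (Φ u) - y‖ ^ 2 / (2 * β ^ 2))))
    -- the unnormalized finite-dimensional densities and their masses `ϖ_β(y)`
    (ϖ : ℝ → EuclideanSpace ℝ (Fin M) → ℝ)
    (hϖ : ∀ β > (0 : ℝ), ∀ y, ϖ β y =
      ∫ z : EuclideanSpace ℝ (Fin N),
        Real.exp (-‖F z - y‖ ^ 2 / (2 * β ^ 2) - (1 / 2) * ∑ i, ∑ j, z i * Θ⁻¹ i j * z j))
    -- the finite-dimensional non-Gaussian components `η^y_β`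
    (ηβ : ℝ → EuclideanSpace ℝ (Fin M) → Measure (EuclideanSpace ℝ (Fin N)))
    (hηβ : ∀ β > (0 : ℝ), ∀ y, ηβ β y = volume.withDensity fun z =>
      ENNReal.ofReal ((ϖ β y)⁻¹ *
        Real.exp (-‖F z - y‖ ^ 2 / (2 * β ^ 2) - (1 / 2) * ∑ i, ∑ j, z i * Θ⁻¹ i j * z j))) :
    ∀ β > (0 : ℝ), ∀ y : EuclideanSpace ℝ (Fin M),
      Integrable (fun z : EuclideanSpace ℝ (Fin N) =>
        Real.exp (-‖F z - y‖ ^ 2 / (2 * β ^ 2) - (1 / 2) * ∑ i, ∑ j, z i * Θ⁻¹ i j * z j)) ∧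
      0 < ϖ β y ∧
      post β y = μφ.conv ((ηβ β y).map ϕT) := by
  have hG := hμ.isGaussian_s5
  have hFc : Continuous F := continuous_iff_continuousAt.2 fun z => by
    obtain ⟨L, hL⟩ := hF (‖z‖ + 1) (by positivity)
    exact hL.continuousOn.continuousAt (isOpen_ball.mem_nhds (by simp))
  have hsymm : ∀ f g : X, ⟪K f, g⟫ = ⟪K g, f⟫ := fun f g => by
    rw [hK, hK]
    simp only [mul_comm]
  obtain ⟨p, hp⟩ : ∃ p : Fin N → X, p = fun i => (InnerProductSpace.toDual ℝ X).symm (φ i) :=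
    ⟨_, rfl⟩
  have hφp : ∀ i u, φ i u = ⟪p i, u⟫ := fun i u => by simp [hp]
  have hΘK : ∀ i j, Θ i j = ⟪K (p j), p i⟫ := fun i j => by
    rw [hΘdef, hθ, hφp, real_inner_comm, hp]
  have hΘT : Θ.transpose = Θ := by
    ext i j
    rw [Matrix.transpose_apply, hΘK, hΘK, hsymm]
  have hΘiT : ∀ i j, Θ⁻¹ i j = Θ⁻¹ j i := fun i j => by
    conv_lhs => rw [← hΘT, ← Matrix.transpose_nonsing_inv, Matrix.transpose_apply]
  -- `Φ` as a continuous linear map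
  obtain ⟨W, hW⟩ : ∃ W : X →L[ℝ] EuclideanSpace ℝ (Fin N), ∀ u i, W u i = φ i u :=
    ⟨(EuclideanSpace.equiv (Fin N) ℝ).symm.toContinuousLinearMap ∘L ContinuousLinearMap.pi φ,
      fun _ _ => rfl⟩
  have hΦW : Φ = W := by
    ext u i
    rw [hΦ, hW]
  have hWadj : ∀ t, W.adjoint t = ∑ i, t i • p i := fun t => by
    refine ext_inner_right ℝ fun u => ?_
    rw [ContinuousLinearMap.adjoint_inner_left, sum_inner, PiLp.inner_apply]
    refine Finset.sum_congr rfl fun i _ => ?_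
    rw [real_inner_smul_left, hW, hφp]
    simp [mul_comm]
  have hKW : ∀ t, K (W.adjoint t) = ∑ i, t i • θ i := fun t => by
    simp [hWadj, hθ, hp]
  have hWKW : ∀ t, W (K (W.adjoint t)) = Matrix.toEuclideanCLM (𝕜 := ℝ) Θ t := fun t => by
    ext i
    rw [hW, hKW, Matrix.ofLp_toEuclideanCLM]
    simp [Matrix.mulVec, dotProduct, hΘdef, mul_comm]
  have hΘpsd : Θ.PosSemidef := by
    refine .of_dotProduct_mulVec_nonneg (by simpa [Matrix.IsHermitian] using hΘT) fun x => ?_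
    have h1 := Matrix.inner_toEuclideanCLM Θ (WithLp.toLp 2 x) (WithLp.toLp 2 x)
    rw [← hWKW, ← ContinuousLinearMap.adjoint_inner_left, real_inner_comm, hK] at h1
    simp only [star_trivial]
    rw [← h1]
    exact integral_nonneg fun u => mul_self_nonneg _
  have hΘpd : Θ.PosDef := hΘpsd.posDef_iff_det_ne_zero.2 hΘinv.ne_zero
  -- `ϕT` as a continuous linear map
  obtain ⟨T, hT⟩ : ∃ T : EuclideanSpace ℝ (Fin N) →L[ℝ] X,
      ∀ z, T z = K (W.adjoint (Matrix.toEuclideanCLM (𝕜 := ℝ) Θ⁻¹ z)) :=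
    ⟨K ∘L W.adjoint ∘L Matrix.toEuclideanCLM (𝕜 := ℝ) Θ⁻¹, fun _ => rfl⟩
  have hϕTT : ϕT = T := by
    ext z
    rw [hϕT]
    simp only [hT, hKW, hϕ, Finset.smul_sum,
      Matrix.ofLp_toEuclideanCLM, Matrix.mulVec, dotProduct, Finset.sum_smul, smul_smul]
    rw [Finset.sum_comm]
    simp only [mul_comm, hΘiT]
  obtain ⟨R, hRdef⟩ : ∃ R : X →L[ℝ] X, ∀ u, R u = u - T (W u) :=
    ⟨ContinuousLinearMap.id ℝ X - T ∘L W, fun _ => rfl⟩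
  have hR : (fun u => u - ϕT (Φ u)) = R := by
    ext u
    rw [hϕTT, hΦW, hRdef]
  have hRK : ∀ t, R (K (W.adjoint t)) = 0 := fun t => by
    have : Matrix.toEuclideanCLM (𝕜 := ℝ) Θ⁻¹ (Matrix.toEuclideanCLM (𝕜 := ℝ) Θ t) = t := by
      ext i
      simp [Matrix.ofLp_toEuclideanCLM, Matrix.nonsing_inv_mul _ hΘinv]
    rw [hRdef, hWKW, hT, this, sub_self]
  have hind : IndepFun R W μ := hμ.indepFun_of_comp_eq_zero hK R W hRK
  obtain ⟨c, hc, hlaw⟩ := multivariateGaussian_eq_withDensity hΘpd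
  rw [← hμ.map_eq_multivariateGaussian hK W hΘpsd hWKW] at hlaw
  intro β hβ y
  obtain ⟨e, he⟩ : ∃ e : EuclideanSpace ℝ (Fin N) → ℝ,
      ∀ z, e z = Real.exp (-‖F z - y‖ ^ 2 / (2 * β ^ 2)) := ⟨_, fun _ => rfl⟩
  obtain ⟨g, hg⟩ : ∃ g : EuclideanSpace ℝ (Fin N) → ℝ,
      ∀ z, g z = Real.exp (-(1 / 2) * ∑ i, ∑ j, z i * Θ⁻¹ i j * z j) := ⟨_, fun _ => rfl⟩
  have heg : ∀ z : EuclideanSpace ℝ (Fin N), Real.exp (-‖F z - y‖ ^ 2 / (2 * β ^ 2) -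
      1 / 2 * ∑ i, ∑ j, z i * Θ⁻¹ i j * z j) = e z * g z := fun z => by
    rw [he, hg, ← Real.exp_add]
    congr 1
    ring
  simp only [← hg] at hlaw
  specialize hω β hβ y
  specialize hpost β hβ y
  specialize hϖ β hβ y
  specialize hηβ β hβ y
  simp only [heg] at hϖ hηβ ⊢
  simp only [← he, hΦW] at hω hpost
  have hem : Measurable e := by
    rw [funext he]
    have := hFc.measurable
    fun_prop
  have hgm : Measurable g := by
    rw [funext hg]
    fun_prop
  have he0 : ∀ z, 0 < e z := fun z => by simpa only [he] using Real.exp_pos _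
  have hg0 : ∀ z, 0 < g z := fun z => by simpa only [hg] using Real.exp_pos _
  have he1 : ∀ z, e z ≤ 1 := fun z => by
    rw [he, Real.exp_le_one_iff, neg_div, neg_nonpos]
    positivity
  have hPprob : IsProbabilityMeasure (μ.map W) :=
    Measure.isProbabilityMeasure_map W.continuous.aemeasurable
  obtain ⟨hint, hpos, hdens⟩ := withDensity_normalized_eq hc hem hgm he0 he1 hg0 hlaw
  rw [integral_map W.continuous.aemeasurable hem.aestronglyMeasurable, ← hω, ← hϖ, ← hηβ] at hdens
  refine ⟨hint, hϖ ▸ hpos, ?_⟩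
  rw [hμφ, hR, hϕTT, hpost, ← hdens]
  have hsplit : ∀ u, R u + T (W u) = u := fun u => by rw [hRdef, sub_add_cancel]
  have hm : Measurable fun z => ENNReal.ofReal ((ω β y)⁻¹ * e z) := by fun_prop
  have hRm := R.continuous.measurable
  have hWm := W.continuous.measurable
  have hTm := T.continuous.measurable
  have hconv := withDensity_comp_eq_conv hRm hWm hTm hind hsplit hm
  exact hconv

end
end

section
/- Let Y be a real separable Hilbert space, let T : X → Y be continuous, and assume that for every y' ∈ Y the preimage T⁻¹(y') is weakly sequentially closed in X. Let y ∈ T(X) and r > 0. Then the supremum of u ↦ μ(B_r(u)) over T⁻¹(y) is attained: there exists u_r ∈ X with T(u_r) = y and μ(B_r(u_r)) = sup_{u ∈ T⁻¹(y)} μ(B_r(u)), where B_r(u) is the open ball of radius r centered at u. -/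
open MeasureTheory ProbabilityTheory Filter Topology Metric
open scoped ENNReal NNReal RealInnerProductSpace

noncomputable section

/-- A line meets a sphere of an inner product space in finitely many points. -/
lemma finite_setOf_norm_add_smul_eq {E : Type*} [NormedAddCommGroup E] [InnerProductSpace ℝ E]
    {h : E} (hh : h ≠ 0) (a : E) (r : ℝ) : {t : ℝ | ‖a + t • h‖ = r}.Finite := by
  have expand (t : ℝ) : ‖a + t • h‖ ^ 2 = ‖a‖ ^ 2 + 2 * (t * ⟪a, h⟫) + t ^ 2 * ‖h‖ ^ 2 := by
    rw [norm_add_sq_real, inner_smul_right, norm_smul, mul_pow, Real.norm_eq_abs, sq_abs]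
  have hpos : ‖h‖ ^ 2 ≠ 0 := by simpa using hh
  rcases Set.eq_empty_or_nonempty {t : ℝ | ‖a + t • h‖ = r} with h0 | ⟨s, hs⟩
  · simp [h0]
  refine (Set.toFinite {s, -(2 * ⟪a, h⟫) / ‖h‖ ^ 2 - s}).subset fun t ht ↦ ?_
  have key : (t - s) * (2 * ⟪a, h⟫ + (t + s) * ‖h‖ ^ 2) = 0 := by
    have h1 := expand t
    have h2 := expand s
    rw [Set.mem_ofPred_eq] at hs ht
    rw [ht] at h1
    rw [hs] at h2
    linarith
  rcases mul_eq_zero.1 key with h1 | h1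
  · exact Or.inl (by linarith)
  · right
    rw [Set.mem_singleton_iff, eq_sub_iff_add_eq, eq_div_iff hpos]
    linarith

/-- Spheres are null sets for a Gaussian measure on a Hilbert space which is not a Dirac mass. -/
lemma ProbabilityTheory.IsGaussian.measure_sphere_eq_zero {E : Type*} [NormedAddCommGroup E]
    [InnerProductSpace ℝ E] [CompleteSpace E] [SecondCountableTopology E] [MeasurableSpace E]
    [BorelSpace E] {μ : Measure E} [IsGaussian μ] (hμ : ∀ x, μ ≠ Measure.dirac x)
    (x : E) (r : ℝ) : μ (sphere x r) = 0 := by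
  obtain ⟨L, hL⟩ : ∃ L : StrongDual ℝ E, Var[L; μ] ≠ 0 := by
    contrapose! hμ
    exact ⟨_, IsGaussian.eq_dirac_of_variance_eq_zero hμ⟩
  have hmem : MemLp id 2 μ := IsGaussian.memLp_two_id
  obtain ⟨f, rfl⟩ := (InnerProductSpace.toDual ℝ E).surjective L
  set v : ℝ := covarianceBilin μ f f with hv
  have hv0 : v ≠ 0 := by
    rw [hv, covarianceBilin_self hmem]
    exact hL
  set h : E := v⁻¹ • (InnerProductSpace.toDual ℝ E).symm (covarianceBilin μ f) with hh
  have inner_h (z : E) : ⟪z, h⟫ = v⁻¹ * covarianceBilin μ f z := by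
    rw [hh, inner_smul_right, real_inner_comm, InnerProductSpace.toDual_symm_apply]
  have h0 : h ≠ 0 := by
    intro h0
    have := inner_h f
    rw [h0, inner_zero_right, ← hv, inv_mul_cancel₀ hv0] at this
    exact zero_ne_one this
  let A : E →L[ℝ] E := ContinuousLinearMap.id ℝ E - (innerSL ℝ f).smulRight h
  have hA (ω : E) : A ω = ω - ⟪f, ω⟫ • h := by simp [A]
  have hgauss : HasGaussianLaw (fun ω ↦ (A ω, innerSL ℝ f ω)) μ :=
    ⟨inferInstanceAs (IsGaussian (μ.map (A.prod (innerSL ℝ f))))⟩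
  have hmemL (z : E) : MemLp (fun ω ↦ ⟪z, ω⟫) 2 μ :=
    IsGaussian.memLp_dual μ (innerSL ℝ z) 2 (by simp)
  have hindep : IndepFun A (innerSL ℝ f) μ := by
    refine hgauss.indepFun_of_covariance_inner fun z c ↦ ?_
    have e1 : (fun ω ↦ ⟪z, A ω⟫) = (fun ω ↦ ⟪z, ω⟫) - fun ω ↦ ⟪z, h⟫ * ⟪f, ω⟫ := by
      ext ω
      simp [hA, inner_sub_right, inner_smul_right, mul_comm]
    have e2 : (fun ω ↦ ⟪c, innerSL ℝ f ω⟫) = fun ω ↦ c * ⟪f, ω⟫ := by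
      ext ω
      simp [mul_comm]
    rw [e1, e2, covariance_const_mul_right,
      covariance_sub_left (hmemL z) ((hmemL f).const_mul _) (hmemL f), covariance_const_mul_left,
      ← covarianceBilin_apply_eq_cov hmem, ← covarianceBilin_apply_eq_cov hmem, ← hv, inner_h,
      covarianceBilin_comm z f]
    field_simp
    simp
  have hnull : NullSingletonClass (μ.map (innerSL ℝ f)) := by
    rw [IsGaussian.map_eq_gaussianReal]
    refine nullSingletonClass_gaussianReal ?_
    rw [ne_eq, Real.toNNReal_eq_zero, not_le]
    exact lt_of_le_of_ne (variance_nonneg _ _) (Ne.symm hL)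
  have hS : MeasurableSet {p : E × ℝ | ‖(p.1 - x) + p.2 • h‖ = r} :=
    (isClosed_eq (by fun_prop) continuous_const).measurableSet
  have hpre : sphere x r =
      (fun ω ↦ (A ω, innerSL ℝ f ω)) ⁻¹' {p : E × ℝ | ‖(p.1 - x) + p.2 • h‖ = r} := by
    ext ω
    have : A ω - x + ⟪f, ω⟫ • h = ω - x := by rw [hA]; abel
    simp [this]
  rw [hpre, ← Measure.map_apply (by fun_prop) hS,
    (indepFun_iff_map_prod_eq_prod_map_map (by fun_prop) (by fun_prop)).1 hindep,
    Measure.measure_prod_null hS]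
  exact .of_forall fun w ↦ (finite_setOf_norm_add_smul_eq h0 (w - x) r).measure_zero _

/-- A bounded sequence in a separable Hilbert space has a weakly convergent subsequence. -/
lemma exists_subseq_tendsto_inner_of_norm_le {E : Type*} [NormedAddCommGroup E]
    [InnerProductSpace ℝ E] [CompleteSpace E] [SecondCountableTopology E] {u : ℕ → E} {R : ℝ}
    (hu : ∀ n, ‖u n‖ ≤ R) :
    ∃ (x : E) (φ : ℕ → ℕ), StrictMono φ ∧
      ∀ w, Tendsto (fun n ↦ ⟪w, u (φ n)⟫) atTop (𝓝 ⟪w, x⟫) := by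
  obtain ⟨l, -, φ, hφ, hl⟩ := WeakDual.isSeqCompact_closedBall ℝ E 0 R
    (x := fun n ↦ StrongDual.toWeakDual (InnerProductSpace.toDual ℝ E (u n)))
    (fun n ↦ by simpa using hu n)
  refine ⟨(InnerProductSpace.toDual ℝ E).symm (WeakDual.toStrongDual l), φ, hφ, fun w ↦ ?_⟩
  have := ((WeakDual.eval_continuous (𝕜 := ℝ) w).tendsto l).comp hl
  rw [real_inner_comm, InnerProductSpace.toDual_symm_apply]
  refine this.congr fun n ↦ ?_
  simp [real_inner_comm]

/-- If `u n` converges weakly to `x` and `z` lies in infinitely many balls `ball (u n) r`, then `z`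
lies in `closedBall x r`. -/
lemma mem_closedBall_of_frequently_mem_ball {E : Type*} [NormedAddCommGroup E]
    [InnerProductSpace ℝ E] {u : ℕ → E} {x z : E} {r : ℝ}
    (hu : ∀ w, Tendsto (fun n ↦ ⟪w, u n⟫) atTop (𝓝 ⟪w, x⟫))
    (hz : ∃ᶠ n in atTop, z ∈ ball (u n) r) : z ∈ closedBall x r := by
  have hlim : Tendsto (fun n ↦ ⟪z - x, z - u n⟫) atTop (𝓝 ⟪z - x, z - x⟫) := by
    simp_rw [inner_sub_right (z - x)]
    exact (hu (z - x)).const_sub _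
  have hle : ⟪z - x, z - x⟫ ≤ ‖z - x‖ * r := by
    refine le_of_tendsto_of_frequently hlim (hz.mono fun n hn ↦ ?_)
    rw [mem_ball, dist_eq_norm] at hn
    exact (real_inner_le_norm _ _).trans (by gcongr)
  rw [real_inner_self_eq_norm_mul_norm] at hle
  rw [mem_closedBall, dist_eq_norm]
  obtain ⟨n, hn⟩ := hz.exists
  rcases (norm_nonneg (z - x)).eq_or_lt with h0 | h0
  · rw [← h0]
    exact (pos_of_mem_ball hn).le
  · exact le_of_mul_le_mul_left hle h0

/-- Along a weakly convergent sequence of centres, the limit of the measures of open balls is at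
most the measure of the closed ball around the weak limit. -/
lemma le_measure_closedBall_of_tendsto {E : Type*} [NormedAddCommGroup E] [InnerProductSpace ℝ E]
    [MeasurableSpace E] [OpensMeasurableSpace E] {μ : Measure E} [IsFiniteMeasure μ] {u : ℕ → E}
    {x : E} {r : ℝ} {s : ℝ≥0∞} (hu : ∀ w, Tendsto (fun n ↦ ⟪w, u n⟫) atTop (𝓝 ⟪w, x⟫))
    (hs : Tendsto (fun n ↦ μ (ball (u n) r)) atTop (𝓝 s)) : s ≤ μ (closedBall x r) := by
  let B : ℕ → Set E := fun n ↦ ⋃ k ≥ n, ball (u k) r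
  have hB : Tendsto (fun n ↦ μ (B n)) atTop (𝓝 (μ (⋂ n, B n))) := by
    refine tendsto_measure_iInter_atTop (fun n ↦ ?_) (fun m n hmn ↦ ?_) ⟨0, measure_ne_top _ _⟩
    · exact (isOpen_biUnion fun _ _ ↦ isOpen_ball).measurableSet.nullMeasurableSet
    · exact Set.biUnion_subset_biUnion_left fun k hk ↦ le_trans hmn hk
  refine (le_of_tendsto_of_tendsto' hs hB fun n ↦ measure_mono ?_).trans (measure_mono ?_)
  · exact Set.subset_biUnion_of_mem (u := fun k ↦ ball (u k) r) (le_refl n)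
  · intro z hz
    refine mem_closedBall_of_frequently_mem_ball hu (frequently_atTop.2 fun n ↦ ?_)
    simpa [B] using Set.mem_iInter.1 hz n

/-- For a finite measure on a complete separable normed group, centres of balls of fixed radius whose
measure is bounded below form a bounded set. -/
lemma exists_norm_le_of_lt_measure_ball {E : Type*} [NormedAddCommGroup E] [CompleteSpace E]
    [SecondCountableTopology E] [MeasurableSpace E] [BorelSpace E] (μ : Measure E)
    [IsFiniteMeasure μ] (r : ℝ) {c : ℝ≥0∞} (hc : 0 < c) :
    ∃ R : ℝ, ∀ u, c < μ (ball u r) → ‖u‖ ≤ R := by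
  have htight := tendsto_measure_norm_gt_of_isTightMeasureSet
    (isTightMeasureSet_singleton (μ := μ))
  simp only [Set.mem_singleton_iff, iSup_iSup_eq_left] at htight
  obtain ⟨R, hR⟩ := (htight.eventually (gt_mem_nhds hc)).exists
  refine ⟨R + r, fun u hu ↦ ?_⟩
  by_contra! hlt
  refine (hu.trans_le (measure_mono fun z hz ↦ ?_)).not_gt hR
  rw [mem_ball, dist_eq_norm, norm_sub_rev] at hz
  have := norm_sub_norm_le u z
  rw [Set.mem_ofPred_eq]
  linarith

theorem statement_15
    {X : Type*} [NormedAddCommGroup X] [InnerProductSpace ℝ X] [CompleteSpace X]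
    [SecondCountableTopology X] [MeasurableSpace X] [BorelSpace X]
    {Y : Type*} [NormedAddCommGroup Y] [InnerProductSpace ℝ Y] [CompleteSpace Y]
    [SecondCountableTopology Y]
    (μ : Measure X) [IsProbabilityMeasure μ] (hμ : IsCenteredGaussian μ)
    (K : X →L[ℝ] X)
    (hK : ∀ f g : X, ⟪K f, g⟫ = ∫ u, ⟪f, u⟫ * ⟪g, u⟫ ∂μ)
    -- `T` is continuous with weakly sequentially closed level sets
    (T : X → Y) (hT : Continuous T)
    (hTw : ∀ (y' : Y) (u : ℕ → X) (x : X), (∀ n, T (u n) = y') →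
      (∀ w : X, Tendsto (fun n => ⟪w, u n⟫) atTop (𝓝 ⟪w, x⟫)) → T x = y')
    (y : Y) (hy : y ∈ Set.range T)
    (r : ℝ) (hr : 0 < r) :
    ∃ uᵣ : X, T uᵣ = y ∧ μ (ball uᵣ r) = ⨆ u ∈ T ⁻¹' {y}, μ (ball u r) := by
  have hG : IsGaussian μ := isGaussian_of_map_eq_gaussianReal fun L ↦ ⟨0, hμ L⟩
  obtain ⟨u₀, hu₀⟩ := hy
  suffices H : ∃ x, T x = y ∧ ⨆ u ∈ T ⁻¹' {y}, μ (ball u r) ≤ μ (ball x r) by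
    obtain ⟨x, hx, hle⟩ := H
    exact ⟨x, hx, (le_iSup₂ (f := fun u (_ : u ∈ T ⁻¹' {y}) ↦ μ (ball u r)) x hx).antisymm hle⟩
  by_cases hdirac : ∃ m, μ = Measure.dirac m
  · obtain ⟨m, rfl⟩ := hdirac
    by_cases hm : ∃ u, T u = y ∧ m ∈ ball u r
    · obtain ⟨u, hu, hmu⟩ := hm
      refine ⟨u, hu, iSup₂_le fun _ _ ↦ prob_le_one.trans ?_⟩
      rw [Measure.dirac_apply_of_mem hmu]
    · push Not at hm
      refine ⟨u₀, hu₀, iSup₂_le fun u hu ↦ ?_⟩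
      simp [Measure.dirac_apply' _ measurableSet_ball, hm u hu]
  push Not at hdirac
  rcases eq_zero_or_pos (⨆ u ∈ T ⁻¹' {y}, μ (ball u r)) with h0 | hpos
  · exact ⟨u₀, hu₀, h0.trans_le zero_le⟩
  obtain ⟨c, hc0, hc⟩ := exists_between hpos
  obtain ⟨R, hR⟩ := exists_norm_le_of_lt_measure_ball μ r hc0
  rw [← sSup_image] at hc ⊢
  obtain ⟨a, -, ha, hamem⟩ := exists_seq_tendsto_sSup
    (S := (fun u ↦ μ (ball u r)) '' (T ⁻¹' {y})) ⟨_, u₀, hu₀, rfl⟩ (OrderTop.bddAbove _)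
  choose u hu hau using hamem
  obtain rfl : (fun n ↦ μ (ball (u n) r)) = a := funext hau
  obtain ⟨N, hN⟩ := eventually_atTop.1 (ha.eventually (lt_mem_nhds hc))
  obtain ⟨x, φ, hφ, hx⟩ := exists_subseq_tendsto_inner_of_norm_le
    (u := fun n ↦ u (n + N)) (fun n ↦ hR _ (hN _ (Nat.le_add_left _ _)))
  have hshift : Tendsto (fun n ↦ φ n + N) atTop atTop :=
    (tendsto_add_atTop_nat N).comp hφ.tendsto_atTop
  refine ⟨x, hTw y _ x (fun n ↦ hu (φ n + N)) hx, ?_⟩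
  refine (le_measure_closedBall_of_tendsto hx (ha.comp hshift)).trans ?_
  rw [← ball_union_sphere]
  refine (measure_union_le _ _).trans_eq ?_
  rw [IsGaussian.measure_sphere_eq_zero hdirac, add_zero]

end
end
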